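/- arXiv:cs/0701061 — 2 statements merged into one kernel-verified Lean document; each statement's English description precedes it below -/
import Mathlib

section
/- Let D ∈ ℂ^{n×n} be Hermitian and μ ∈ ℝ. Then the minimum of ‖D − μI + X‖_F over all Hermitian positive semidefinite matrices X ∈ ℂ^{n×n} equals ‖(D − μI)₊‖_F, and it is attained at X = −(D − μI)₋. -/
open Matrix ComplexOrder

/-- The Frobenius norm of a complex matrix: `‖M‖_F = (Tr(M† M))^{1/2}`. -/
noncomputable def frobNorm {n : ℕ} (M : Matrix (Fin n) (Fin n) ℂ) : ℝ :=
  Real.sqrt (Matrix.trace (Mᴴ * M)).re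

theorem frobNorm_eq_sqrt_sum {n : ℕ} (M : Matrix (Fin n) (Fin n) ℂ) :
    frobNorm M = Real.sqrt (∑ i, ∑ j, ‖M j i‖ ^ 2) := by
  simp only [frobNorm, Matrix.trace, Matrix.diag_apply, Matrix.mul_apply,
    Matrix.conjTranspose_apply, Complex.re_sum]
  congr 1
  refine Finset.sum_congr rfl fun i _ => Finset.sum_congr rfl fun j _ => ?_
  rw [Complex.star_def, Complex.conj_mul', ← Complex.ofReal_pow, Complex.ofReal_re]

theorem frobNorm_unitary_conj {n : ℕ} {U : Matrix (Fin n) (Fin n) ℂ}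
    (hU : U ∈ Matrix.unitaryGroup (Fin n) ℂ) (M : Matrix (Fin n) (Fin n) ℂ) :
    frobNorm (U * M * Uᴴ) = frobNorm M := by
  have hUU : Uᴴ * U = 1 := Matrix.mem_unitaryGroup_iff'.mp hU
  have h : (U * M * Uᴴ)ᴴ * (U * M * Uᴴ) = U * (Mᴴ * M * Uᴴ) := by
    simp only [Matrix.conjTranspose_mul, Matrix.conjTranspose_conjTranspose, Matrix.mul_assoc]
    rw [← Matrix.mul_assoc Uᴴ U, hUU, Matrix.one_mul]
  rw [frobNorm, frobNorm, h, Matrix.trace_mul_comm, Matrix.mul_assoc, hUU, Matrix.mul_one]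

theorem frobNorm_diagonal_max_le {n : ℕ} (d : Fin n → ℝ) {Y : Matrix (Fin n) (Fin n) ℂ}
    (hY : Y.PosSemidef) :
    frobNorm (Matrix.diagonal fun i => Complex.ofReal (max (d i) 0))
      ≤ frobNorm ((Matrix.diagonal fun i => Complex.ofReal (d i)) + Y) := by
  rw [frobNorm_eq_sqrt_sum, frobNorm_eq_sqrt_sum]
  refine Real.sqrt_le_sqrt (Finset.sum_le_sum fun i _ => Finset.sum_le_sum fun j _ => ?_)
  refine pow_le_pow_left₀ (norm_nonneg _) ?_ 2
  rcases eq_or_ne j i with rfl | hji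
  · have hre : 0 ≤ (Y j j).re := (Complex.nonneg_iff.mp (hY.diag_nonneg (i := j))).1
    rw [Matrix.add_apply, Matrix.diagonal_apply_eq, Matrix.diagonal_apply_eq, Complex.norm_real,
      Real.norm_of_nonneg (le_max_right _ _)]
    refine max_le ?_ (norm_nonneg _)
    calc d j ≤ (Complex.ofReal (d j) + Y j j).re := by simpa using hre
      _ ≤ _ := Complex.re_le_norm _
  · simp [Matrix.diagonal_apply_ne _ hji]

/-- Let `D` be Hermitian with spectral decomposition `D = U diag(λ₁,…,λₙ) U†` and `μ ∈ ℝ`.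
Then the minimum of `‖D − μI + X‖_F` over Hermitian positive semidefinite `X` equals
`‖(D − μI)₊‖_F = ‖U diag(max{λᵢ−μ,0}) U†‖_F`, attained at
`X = −(D − μI)₋ = −U diag(min{λᵢ−μ,0}) U†`. -/
theorem min_frobNorm_over_psd {n : ℕ} (D U : Matrix (Fin n) (Fin n) ℂ)
    (l : Fin n → ℝ) (μ : ℝ) (hU : U ∈ Matrix.unitaryGroup (Fin n) ℂ)
    (hD : D = U * Matrix.diagonal (fun i => Complex.ofReal (l i)) * Uᴴ) :
    (-(U * Matrix.diagonal (fun i => Complex.ofReal (min (l i - μ) 0)) * Uᴴ)).PosSemidef ∧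
    frobNorm (D - μ • (1 : Matrix (Fin n) (Fin n) ℂ)
        + -(U * Matrix.diagonal (fun i => Complex.ofReal (min (l i - μ) 0)) * Uᴴ))
      = frobNorm (U * Matrix.diagonal (fun i => Complex.ofReal (max (l i - μ) 0)) * Uᴴ) ∧
    ∀ X : Matrix (Fin n) (Fin n) ℂ, X.PosSemidef →
      frobNorm (U * Matrix.diagonal (fun i => Complex.ofReal (max (l i - μ) 0)) * Uᴴ)
        ≤ frobNorm (D - μ • (1 : Matrix (Fin n) (Fin n) ℂ) + X) := by
  have hUU : U * Uᴴ = 1 := Matrix.mem_unitaryGroup_iff.mp hU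
  have hshift : D - μ • (1 : Matrix (Fin n) (Fin n) ℂ)
      = U * Matrix.diagonal (fun i => Complex.ofReal (l i - μ)) * Uᴴ := by
    have hdiag : Matrix.diagonal (fun i => Complex.ofReal (l i - μ))
        = Matrix.diagonal (fun i => Complex.ofReal (l i))
          - μ • (1 : Matrix (Fin n) (Fin n) ℂ) := by
      ext i j
      rcases eq_or_ne i j with rfl | hij
      · simp
      · simp [hij]
    rw [hdiag, hD, Matrix.mul_sub, Matrix.sub_mul, Matrix.mul_smul, Matrix.mul_one,
      Matrix.smul_mul, hUU]
  refine ⟨?_, ?_, fun X hX => ?_⟩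
  · rw [← Matrix.neg_mul, ← Matrix.mul_neg, Matrix.diagonal_neg]
    refine Matrix.PosSemidef.mul_mul_conjTranspose_same
      (Matrix.PosSemidef.diagonal fun i => ?_) U
    simp [← Complex.ofReal_neg]
  · rw [hshift, ← sub_eq_add_neg, ← Matrix.sub_mul, ← Matrix.mul_sub, Matrix.diagonal_sub]
    congr 4
    funext i
    rw [← Complex.ofReal_sub]
    congr 1
    linarith [min_add_max (l i - μ) 0]
  · have hXU : X = U * (Uᴴ * X * U) * Uᴴ := by
      simp only [Matrix.mul_assoc, hUU, Matrix.mul_one]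
      rw [← Matrix.mul_assoc, hUU, Matrix.one_mul]
    rw [hshift, hXU, ← Matrix.add_mul, ← Matrix.mul_add, frobNorm_unitary_conj hU,
      frobNorm_unitary_conj hU]
    exact frobNorm_diagonal_max_le _ (hX.conjTranspose_mul_mul_same U)
end

section
/- (Correctness of the projection algorithm) Let D ∈ ℂ^{n×n} be Hermitian with eigenvalues λ₁,…,λₙ, let P > 0, and let ψ(μ) = −½ Σ_{j=1}^{n} (max{0, λⱼ − μ})² − μP + ½‖D‖_F². If μ* ≥ 0 maximizes ψ over [0, ∞), then D̃* = (D − μ*I)₊ belongs to Ω₊(P) and is the unique minimizer of ‖D̃ − D‖_F over Ω₊(P): for every Hermitian positive semidefinite D̃ with Re Tr(D̃) ≤ P, ‖D − D̃*‖_F ≤ ‖D − D̃‖_F, with equality only if D̃ = D̃*. -/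
open Matrix ComplexOrder

theorem frobNorm_nonneg {n : ℕ} (M : Matrix (Fin n) (Fin n) ℂ) : 0 ≤ frobNorm M :=
  Real.sqrt_nonneg _

theorem frobNorm_sq {n : ℕ} (M : Matrix (Fin n) (Fin n) ℂ) :
    frobNorm M ^ 2 = ∑ i, ∑ j, Complex.normSq (M i j) := by
  have h : (Matrix.trace (Mᴴ * M)).re = ∑ i, ∑ j, Complex.normSq (M i j) := by
    rw [Finset.sum_comm]
    simp [Matrix.trace, Matrix.mul_apply, Complex.normSq_apply]
  rw [frobNorm, h, Real.sq_sqrt]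
  exact Finset.sum_nonneg fun i _ => Finset.sum_nonneg fun j _ => Complex.normSq_nonneg _

theorem eq_zero_of_frobNorm_sq_nonpos {n : ℕ} {M : Matrix (Fin n) (Fin n) ℂ}
    (h : frobNorm M ^ 2 ≤ 0) : M = 0 := by
  rw [frobNorm_sq] at h
  ext i j
  have hj : ∀ i, ∀ j ∈ Finset.univ, 0 ≤ Complex.normSq (M i j) :=
    fun i j _ => Complex.normSq_nonneg _
  have hi : ∀ i ∈ Finset.univ, 0 ≤ ∑ j, Complex.normSq (M i j) :=
    fun i _ => Finset.sum_nonneg (hj i)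
  have h1 := (Finset.single_le_sum hi (Finset.mem_univ i)).trans h
  have h2 := (Finset.single_le_sum (hj i) (Finset.mem_univ j)).trans h1
  exact Complex.normSq_eq_zero.1 (le_antisymm h2 (Complex.normSq_nonneg _))

theorem trace_unitary_conj {n : ℕ} {U : Matrix (Fin n) (Fin n) ℂ}
    (hU : U ∈ Matrix.unitaryGroup (Fin n) ℂ) (M : Matrix (Fin n) (Fin n) ℂ) :
    Matrix.trace (U * M * Uᴴ) = Matrix.trace M := by
  have h : Uᴴ * U = 1 := Matrix.mem_unitaryGroup_iff'.1 hU
  rw [Matrix.trace_mul_comm, ← Matrix.mul_assoc, h, Matrix.one_mul]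

theorem sq_max_zero_sub_le (a t : ℝ) : (max 0 (a - t)) ^ 2 ≤ (max a 0 - t) ^ 2 := by
  rcases max_cases 0 (a - t) with ⟨h, h'⟩ | ⟨h, h'⟩ <;>
    rcases max_cases a 0 with ⟨k, k'⟩ | ⟨k, k'⟩ <;> rw [h, k] <;> nlinarith

/-- A maximizer over `[0, ∞)` of the dual function satisfies primal feasibility and
complementary slackness. -/
theorem sum_le_and_slackness_of_dual_max {n : ℕ} {l : Fin n → ℝ} {P μs : ℝ} (hμs : 0 ≤ μs)
    (hmax : ∀ μ : ℝ, 0 ≤ μ →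
      -(1/2) * ∑ j : Fin n, (max 0 (l j - μ)) ^ 2 - μ * P
        ≤ -(1/2) * ∑ j : Fin n, (max 0 (l j - μs)) ^ 2 - μs * P) :
    ∑ i, max (l i - μs) 0 ≤ P ∧ μs * (∑ i, max (l i - μs) 0 - P) = 0 := by
  set c := P - ∑ i, max (l i - μs) 0 with hc
  have hn : (0 : ℝ) ≤ n := Nat.cast_nonneg n
  have hn1 : (0 : ℝ) < n + 1 := by linarith
  have key : ∀ t, -μs ≤ t → 0 ≤ t * (c + n * t / 2) := by
    intro t ht
    have h1 := hmax (μs + t) (by linarith)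
    have h2 : ∑ j, (max 0 (l j - (μs + t))) ^ 2 ≤ ∑ j, (max (l j - μs) 0 - t) ^ 2 := by
      refine Finset.sum_le_sum fun j _ => ?_
      rw [← sub_sub]
      exact sq_max_zero_sub_le _ _
    have h3 : ∑ j, (max (l j - μs) 0 - t) ^ 2
        = ∑ j, (max 0 (l j - μs)) ^ 2 - 2 * t * ∑ j, max (l j - μs) 0 + n * t ^ 2 := by
      simp only [sub_sq, Finset.sum_add_distrib, Finset.sum_sub_distrib, max_comm (0 : ℝ),
        Finset.mul_sum, Finset.sum_const, Finset.card_univ, Fintype.card_fin, nsmul_eq_mul]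
      congr 2
      exact Finset.sum_congr rfl fun j _ => by ring
    rw [h3] at h2
    rw [hc]
    nlinarith
  have hfrac : ∀ x : ℝ, 0 < x → n * (x / (n + 1)) / 2 < x := by
    intro x hx
    rw [← mul_div_assoc, div_div, div_lt_iff₀ (by positivity)]
    nlinarith [mul_nonneg hn hx.le]
  have hc0 : 0 ≤ c := by
    by_contra! h
    have hpos : 0 < -c / (n + 1) := div_pos (by linarith) hn1
    have h1 := key (-c / (n + 1)) (by linarith)
    have h2 := hfrac (-c) (by linarith)
    nlinarith
  refine ⟨by linarith, ?_⟩
  rcases hμs.eq_or_lt with h0 | h0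
  · rw [← h0, zero_mul]
  · suffices hc1 : c = 0 by
      rw [← neg_sub, ← hc, hc1]
      simp
    by_contra hne
    have hcpos : 0 < c := lt_of_le_of_ne hc0 (Ne.symm hne)
    have hs : 0 < min μs (c / (n + 1)) := lt_min h0 (div_pos hcpos hn1)
    have h1 := key (-min μs (c / (n + 1))) (by linarith [min_le_left μs (c / (n + 1))])
    have h2 := hfrac c hcpos
    have h3 := mul_le_mul_of_nonneg_left (min_le_right μs (c / (n + 1))) hn
    nlinarith

/-- Pythagorean inequality for the projection of a real diagonal matrix. -/
theorem frobNorm_sq_diagonal_projection_add_le {n : ℕ} {l : Fin n → ℝ} {P μs : ℝ}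
    (hμs : 0 ≤ μs) (hslack : μs * (∑ i, max (l i - μs) 0 - P) = 0)
    {Y : Matrix (Fin n) (Fin n) ℂ} (hY : Y.PosSemidef) (hYP : (Matrix.trace Y).re ≤ P) :
    frobNorm (Matrix.diagonal (fun i => Complex.ofReal (l i))
        - Matrix.diagonal (fun i => Complex.ofReal (max (l i - μs) 0))) ^ 2
      + frobNorm (Matrix.diagonal (fun i => Complex.ofReal (max (l i - μs) 0)) - Y) ^ 2
      ≤ frobNorm (Matrix.diagonal (fun i => Complex.ofReal (l i)) - Y) ^ 2 := by
  set s : Fin n → ℝ := fun i => max (l i - μs) 0 with hs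
  have hdiag : ∀ i, 0 ≤ (Y i i).re := fun i => (Complex.le_def.1 (hY.diag_nonneg (i := i))).1
  have htr : ∑ i, (Y i i).re ≤ P := by simpa [Matrix.trace] using hYP
  have hinner : 0 ≤ ∑ i, (l i - s i) * (s i - (Y i i).re) := by
    have h1 : ∑ i, μs * (s i - (Y i i).re) ≤ ∑ i, (l i - s i) * (s i - (Y i i).re) := by
      refine Finset.sum_le_sum fun i _ => ?_
      have := hdiag i
      rcases max_cases (l i - μs) 0 with ⟨h, h'⟩ | ⟨h, h'⟩ <;> simp only [hs, h] <;> nlinarith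
    rw [← Finset.mul_sum, Finset.sum_sub_distrib] at h1
    nlinarith [mul_le_mul_of_nonneg_left htr hμs]
  have hexp : ∑ i, ∑ j, Complex.normSq
        ((Matrix.diagonal (fun i => (l i : ℂ)) - Y) i j)
      = ∑ i, ∑ j, Complex.normSq
          ((Matrix.diagonal (fun i => (l i : ℂ)) - Matrix.diagonal (fun i => (s i : ℂ))) i j)
        + ∑ i, ∑ j, Complex.normSq ((Matrix.diagonal (fun i => (s i : ℂ)) - Y) i j)
        + 2 * ∑ i, (l i - s i) * (s i - (Y i i).re) := by
    rw [Finset.mul_sum, ← Finset.sum_add_distrib, ← Finset.sum_add_distrib]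
    refine Finset.sum_congr rfl fun i _ => ?_
    have hsingle : 2 * ((l i - s i) * (s i - (Y i i).re))
        = ∑ j, if i = j then 2 * ((l i - s i) * (s i - (Y i i).re)) else 0 := by simp
    rw [hsingle, ← Finset.sum_add_distrib, ← Finset.sum_add_distrib]
    refine Finset.sum_congr rfl fun j _ => ?_
    by_cases hij : i = j
    · subst hij
      simp [Complex.normSq_apply]
      ring
    · simp [hij]
  rw [frobNorm_sq, frobNorm_sq, frobNorm_sq, hexp]
  linarith

/-- **Correctness of the projection algorithm.** Let `D` be Hermitian with eigenvalues
`λ₁,…,λₙ` (i.e. `D = U diag(λ) U†` for a unitary `U`), `P > 0`, and let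
`ψ(μ) = −½ Σⱼ (max{0, λⱼ − μ})² − μP + ½‖D‖_F²`. If `μ* ≥ 0` maximizes `ψ` over `[0, ∞)`,
then `D̃* = (D − μ*I)₊ = U diag(max{λᵢ−μ*,0}) U†` is positive semidefinite with
`Re Tr(D̃*) ≤ P`, and is the unique Frobenius-norm projection of `D` onto
`Ω₊(P) = {D̃ ⪰ 0 : Tr(D̃) ≤ P}`: for every positive semidefinite `D̃` with
`Re Tr(D̃) ≤ P` we have `‖D − D̃*‖_F ≤ ‖D − D̃‖_F`, with equality only if `D̃ = D̃*`. -/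
theorem projection_algorithm_correct {n : ℕ} (D U : Matrix (Fin n) (Fin n) ℂ)
    (l : Fin n → ℝ) (hU : U ∈ Matrix.unitaryGroup (Fin n) ℂ)
    (hD : D = U * Matrix.diagonal (fun i => Complex.ofReal (l i)) * Uᴴ)
    (P : ℝ) (hP : 0 < P) (μs : ℝ) (hμs : 0 ≤ μs)
    (hmax : ∀ μ : ℝ, 0 ≤ μ →
      -(1/2) * ∑ j : Fin n, (max 0 (l j - μ)) ^ 2 - μ * P + (1/2) * frobNorm D ^ 2
        ≤ -(1/2) * ∑ j : Fin n, (max 0 (l j - μs)) ^ 2 - μs * P + (1/2) * frobNorm D ^ 2) :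
    (U * Matrix.diagonal (fun i => Complex.ofReal (max (l i - μs) 0)) * Uᴴ).PosSemidef ∧
    (Matrix.trace (U * Matrix.diagonal (fun i => Complex.ofReal (max (l i - μs) 0)) * Uᴴ)).re
      ≤ P ∧
    ∀ Dt : Matrix (Fin n) (Fin n) ℂ, Dt.PosSemidef → (Matrix.trace Dt).re ≤ P →
      frobNorm (D - U * Matrix.diagonal (fun i => Complex.ofReal (max (l i - μs) 0)) * Uᴴ)
        ≤ frobNorm (D - Dt) ∧
      (frobNorm (D - U * Matrix.diagonal (fun i => Complex.ofReal (max (l i - μs) 0)) * Uᴴ)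
          = frobNorm (D - Dt) →
        Dt = U * Matrix.diagonal (fun i => Complex.ofReal (max (l i - μs) 0)) * Uᴴ) := by
  have hUU : U * Uᴴ = 1 := Matrix.mem_unitaryGroup_iff.1 hU
  obtain ⟨hsum, hslack⟩ := sum_le_and_slackness_of_dual_max (l := l) (P := P) hμs
    fun μ hμ => by linarith [hmax μ hμ]
  refine ⟨(PosSemidef.diagonal fun i => ?_).mul_mul_conjTranspose_same U, ?_, ?_⟩
  · exact Complex.zero_le_real.2 (le_max_right _ _)
  · rw [trace_unitary_conj hU]
    simpa [Matrix.trace] using hsum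
  · intro Dt hDt htr
    have hDt_eq : Dt = U * (Uᴴ * Dt * U) * Uᴴ := by
      calc Dt = (U * Uᴴ) * Dt * (U * Uᴴ) := by rw [hUU, Matrix.one_mul, Matrix.mul_one]
        _ = U * (Uᴴ * Dt * U) * Uᴴ := by simp only [Matrix.mul_assoc]
    have hY : (Uᴴ * Dt * U).PosSemidef := hDt.conjTranspose_mul_mul_same U
    generalize Uᴴ * Dt * U = Y at hDt_eq hY
    subst hDt_eq
    rw [trace_unitary_conj hU] at htr
    have hpyth := frobNorm_sq_diagonal_projection_add_le hμs hslack hY htr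
    rw [hD, ← Matrix.sub_mul, ← Matrix.mul_sub, ← Matrix.sub_mul, ← Matrix.mul_sub,
      frobNorm_unitary_conj hU, frobNorm_unitary_conj hU]
    refine ⟨?_, fun heq => ?_⟩
    · exact (sq_le_sq₀ (frobNorm_nonneg _) (frobNorm_nonneg _)).1
        (le_trans (le_add_of_nonneg_right (sq_nonneg _)) hpyth)
    · rw [heq] at hpyth
      have hzero := eq_zero_of_frobNorm_sq_nonpos ((add_le_iff_nonpos_right _).1 hpyth)
      rw [sub_eq_zero.1 hzero]
end
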